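/- Let X ⊆ ℝ⁸ be a Cayley subspace and let Xᗮ be its orthogonal complement. Then the triple cross product restricts as follows: (i) if a, b, c ∈ X then a×b×c ∈ X; (ii) if a, b ∈ X and n ∈ Xᗮ then a×b×n ∈ Xᗮ; (iii) if a ∈ X and m, n ∈ Xᗮ then a×m×n ∈ X; (iv) if l, m, n ∈ Xᗮ then l×m×n ∈ Xᗮ. -/

import Mathlib

open scoped RealInnerProductSpace

noncomputable section

abbrev E8 := EuclideanSpace ℝ (Fin 8)

/-- The 4-form `dx_{ijkl}` on `ℝ⁸`. -/
def dx4 (i j k l : Fin 8) (v : Fin 4 → E8) : ℝ :=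
  Matrix.det (Matrix.of fun r s : Fin 4 => v s (![i, j, k, l] r))

/-- The Cayley 4-form `Φ₀` on `ℝ⁸`. -/
def Phi0 (v : Fin 4 → E8) : ℝ :=
  dx4 0 1 2 3 v + dx4 0 1 4 5 v - dx4 0 1 6 7 v + dx4 0 2 4 6 v + dx4 0 2 5 7 v
    + dx4 0 3 4 7 v - dx4 0 3 5 6 v - dx4 1 2 4 7 v + dx4 1 2 5 6 v + dx4 1 3 4 6 v
    + dx4 1 3 5 7 v - dx4 2 3 4 5 v + dx4 2 3 6 7 v + dx4 4 5 6 7 v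

/-- The Cayley form applied to four vectors. -/
def Phi (a b c d : E8) : ℝ := Phi0 ![a, b, c, d]

/-- The `i`-th standard basis vector of `ℝ⁸`. -/
def stdB (i : Fin 8) : E8 := EuclideanSpace.single i 1

/-- The triple cross product: the unique vector with `⟪x, u×v×w⟫ = Φ₀(x,u,v,w)`
for all `x`. -/
def crossTriple (u v w : E8) : E8 :=
  (EuclideanSpace.equiv (Fin 8) ℝ).symm fun i => Phi (stdB i) u v w

/-- A 4-dimensional subspace of `ℝ⁸` is Cayley if it has an orthonormal basis on which
`Φ₀` takes the value `1`. -/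
def IsCayley (V : Submodule ℝ E8) : Prop :=
  Module.finrank ℝ V = 4 ∧
    ∃ v : Fin 4 → E8, (∀ i, v i ∈ V) ∧ Orthonormal ℝ v ∧ Phi0 v = 1

open scoped Matrix

lemma dx4_apply (i j k l : Fin 8) (a b c d : E8) :
    dx4 i j k l ![a, b, c, d] =
      (a i * b j - a j * b i) * (c k * d l - c l * d k)
        - (a i * b k - a k * b i) * (c j * d l - c l * d j)
        + (a i * b l - a l * b i) * (c j * d k - c k * d j)
        + (a j * b k - a k * b j) * (c i * d l - c l * d i)
        - (a j * b l - a l * b j) * (c i * d k - c k * d i)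
        + (a k * b l - a l * b k) * (c i * d j - c j * d i) := by
  simp [dx4, Matrix.det_succ_row_zero, Fin.sum_univ_succ, Fin.succAbove]
  ring

/-- The half-spin part of Clifford multiplication by `u`: the matrix of
`w ↦ u × e₀ × w + ⟪u, e₀⟫ w - ⟪u, w⟫ e₀ + ⟪e₀, w⟫ u`, where `e₀ = stdB 0`. -/
def halfSpinMatrix (u : E8) : Matrix (Fin 8) (Fin 8) ℝ :=
  !![u 0, -u 1, -u 2, -u 3, -u 4, -u 5, -u 6, -u 7;
    u 1, u 0, -u 3, u 2, -u 5, u 4, u 7, -u 6;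
    u 2, u 3, u 0, -u 1, -u 6, -u 7, u 4, u 5;
    u 3, -u 2, u 1, u 0, -u 7, u 6, -u 5, u 4;
    u 4, u 5, u 6, u 7, u 0, -u 1, -u 2, -u 3;
    u 5, -u 4, u 7, -u 6, u 1, u 0, u 3, -u 2;
    u 6, -u 7, -u 4, u 5, u 2, -u 3, u 0, u 1;
    u 7, u 6, -u 5, -u 4, u 3, u 2, -u 1, u 0]

lemma halfSpinMatrix_add (u v : E8) :
    halfSpinMatrix (u + v) = halfSpinMatrix u + halfSpinMatrix v := by
  ext i j
  fin_cases i <;> fin_cases j <;> simp [halfSpinMatrix] <;> ring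

lemma halfSpinMatrix_smul (r : ℝ) (u : E8) :
    halfSpinMatrix (r • u) = r • halfSpinMatrix u := by
  ext i j
  fin_cases i <;> fin_cases j <;> simp [halfSpinMatrix]

lemma real_inner_eq_sum (u v : E8) : ⟪u, v⟫ = u 0 * v 0 + u 1 * v 1 + u 2 * v 2 + u 3 * v 3
    + u 4 * v 4 + u 5 * v 5 + u 6 * v 6 + u 7 * v 7 := by
  simp only [PiLp.inner_apply, Fin.sum_univ_eight, RCLike.inner_apply, conj_trivial, mul_comm]

lemma halfSpinMatrix_mul_transpose_self (u : E8) :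
    halfSpinMatrix u * (halfSpinMatrix u)ᵀ = ⟪u, u⟫ • 1 := by
  ext i j
  rw [real_inner_eq_sum]
  fin_cases i <;> fin_cases j <;>
    simp [halfSpinMatrix, Matrix.mul_apply, Fin.sum_univ_eight] <;> ring

lemma transpose_mul_halfSpinMatrix_self (u : E8) :
    (halfSpinMatrix u)ᵀ * halfSpinMatrix u = ⟪u, u⟫ • 1 := by
  ext i j
  rw [real_inner_eq_sum]
  fin_cases i <;> fin_cases j <;>
    simp [halfSpinMatrix, Matrix.mul_apply, Fin.sum_univ_eight] <;> ring

/-- Clifford multiplication by a vector of `ℝ⁸` on the 16-dimensional spin module. -/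
def cliffordMatrix : E8 →ₗ[ℝ] Matrix (Fin 8 ⊕ Fin 8) (Fin 8 ⊕ Fin 8) ℝ where
  toFun u := Matrix.fromBlocks 0 (halfSpinMatrix u) (halfSpinMatrix u)ᵀ 0
  map_add' u v := by simp [halfSpinMatrix_add, Matrix.fromBlocks_add]
  map_smul' r u := by simp [halfSpinMatrix_smul, Matrix.fromBlocks_smul]

lemma cliffordMatrix_apply (u : E8) :
    cliffordMatrix u = Matrix.fromBlocks 0 (halfSpinMatrix u) (halfSpinMatrix u)ᵀ 0 := rfl

lemma transpose_cliffordMatrix (u : E8) : (cliffordMatrix u)ᵀ = cliffordMatrix u := by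
  simp [cliffordMatrix_apply, Matrix.fromBlocks_transpose]

lemma cliffordMatrix_mul_self (u : E8) :
    cliffordMatrix u * cliffordMatrix u = ⟪u, u⟫ • 1 := by
  simp [cliffordMatrix_apply, Matrix.fromBlocks_multiply, halfSpinMatrix_mul_transpose_self,
    transpose_mul_halfSpinMatrix_self, ← Matrix.fromBlocks_one, Matrix.fromBlocks_smul]

lemma cliffordMatrix_semiconjBy_neg {u v : E8} (h : ⟪u, v⟫ = 0) :
    SemiconjBy (cliffordMatrix u) (cliffordMatrix v) (-cliffordMatrix v) := by
  have key := cliffordMatrix_mul_self (u + v)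
  rw [map_add, add_mul, mul_add, mul_add, cliffordMatrix_mul_self, cliffordMatrix_mul_self,
    real_inner_add_add_self, h, mul_zero, add_zero, add_smul] at key
  rw [SemiconjBy, neg_mul, eq_neg_iff_add_eq_zero]
  rw [← sub_eq_zero] at key
  rw [← key]
  abel

/-- The spinor fixed by the stabilizer of the Cayley form. -/
def cayleySpinor : Fin 8 ⊕ Fin 8 → ℝ := Sum.elim 0 (Pi.single 0 1)

lemma cayleySpinor_dotProduct_self : cayleySpinor ⬝ᵥ cayleySpinor = 1 := by
  simp [cayleySpinor]

lemma cliffordMatrix_mulVec_cayleySpinor (u : E8) :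
    cliffordMatrix u *ᵥ cayleySpinor = Sum.elim u 0 := by
  rw [cliffordMatrix_apply, cayleySpinor, Matrix.fromBlocks_mulVec, Sum.elim_comp_inl,
    Sum.elim_comp_inr]
  congr 1
  · ext i
    fin_cases i <;> simp [halfSpinMatrix]
  · rw [Matrix.mulVec_zero, Matrix.zero_mulVec, add_zero]

set_option maxHeartbeats 1000000 in
lemma dotProduct_halfSpinMatrix (a b c d : E8) :
    (a : Fin 8 → ℝ) ⬝ᵥ (halfSpinMatrix b *ᵥ ((halfSpinMatrix c)ᵀ *ᵥ (d : Fin 8 → ℝ))) =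
      Phi a b c d + ⟪a, b⟫ * ⟪c, d⟫ - ⟪a, c⟫ * ⟪b, d⟫ + ⟪a, d⟫ * ⟪b, c⟫ := by
  simp only [real_inner_eq_sum]
  simp [halfSpinMatrix, dotProduct, Matrix.mulVec, Fin.sum_univ_eight, Phi, Phi0,
    dx4_apply]
  ring

lemma cayleySpinor_dotProduct_cliffordMatrix (a b c d : E8) :
    cayleySpinor ⬝ᵥ ((cliffordMatrix a * cliffordMatrix b * cliffordMatrix c * cliffordMatrix d)
      *ᵥ cayleySpinor) =
      Phi a b c d + ⟪a, b⟫ * ⟪c, d⟫ - ⟪a, c⟫ * ⟪b, d⟫ + ⟪a, d⟫ * ⟪b, c⟫ := by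
  rw [mul_assoc, mul_assoc, ← Matrix.mulVec_mulVec, Matrix.dotProduct_mulVec,
    ← Matrix.mulVec_transpose, transpose_cliffordMatrix, cliffordMatrix_mulVec_cayleySpinor,
    ← Matrix.mulVec_mulVec, ← Matrix.mulVec_mulVec, cliffordMatrix_mulVec_cayleySpinor,
    ← dotProduct_halfSpinMatrix]
  simp [cliffordMatrix_apply, Matrix.fromBlocks_mulVec]

lemma inner_crossTriple (x u v w : E8) : ⟪x, crossTriple u v w⟫ = Phi x u v w := by
  simp [real_inner_eq_sum, crossTriple, stdB, Phi, Phi0, dx4_apply]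
  ring

lemma dotProduct_mulVec_eq_zero_of_semiconjBy_neg {ι : Type*} [Fintype ι] [DecidableEq ι]
    {Q A : Matrix ι ι ℝ} {e : ι → ℝ} (hQ : Qᵀ * Q = 1) (he : Q *ᵥ e = e)
    (h : SemiconjBy Q A (-A)) : e ⬝ᵥ (A *ᵥ e) = 0 := by
  have hQA : e ⬝ᵥ (A *ᵥ e) = (Q *ᵥ e) ⬝ᵥ (Q *ᵥ (A *ᵥ e)) := by
    rw [Matrix.dotProduct_mulVec (Q *ᵥ e), ← Matrix.mulVec_transpose, Matrix.mulVec_mulVec, hQ,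
      Matrix.one_mulVec]
  rw [he, Matrix.mulVec_mulVec, h.eq, ← Matrix.mulVec_mulVec, he, Matrix.neg_mulVec,
    dotProduct_neg] at hQA
  linarith

lemma mulVec_eq_self_of_dotProduct_eq_one {ι : Type*} [Fintype ι] [DecidableEq ι]
    {Q : Matrix ι ι ℝ} {e : ι → ℝ} (hQ : Qᵀ * Q = 1) (he : e ⬝ᵥ e = 1)
    (h : e ⬝ᵥ (Q *ᵥ e) = 1) : Q *ᵥ e = e := by
  have hnorm : (Q *ᵥ e) ⬝ᵥ (Q *ᵥ e) = 1 := by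
    rw [Matrix.dotProduct_mulVec (Q *ᵥ e), ← Matrix.mulVec_transpose, Matrix.mulVec_mulVec, hQ,
      Matrix.one_mulVec, he]
  rw [← sub_eq_zero, ← dotProduct_self_eq_zero, sub_dotProduct, dotProduct_sub, dotProduct_sub,
    hnorm, he, h, dotProduct_comm, h]
  norm_num

/-- The Clifford product of the four vectors of a frame. -/
def frameMatrix (v : Fin 4 → E8) : Matrix (Fin 8 ⊕ Fin 8) (Fin 8 ⊕ Fin 8) ℝ :=
  cliffordMatrix (v 0) * cliffordMatrix (v 1) * cliffordMatrix (v 2) * cliffordMatrix (v 3)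

section Frame

variable {v : Fin 4 → E8}

lemma Orthonormal.transpose_frameMatrix_mul_self (hv : Orthonormal ℝ v) :
    (frameMatrix v)ᵀ * frameMatrix v = 1 := by
  have hsq (i : Fin 4) : cliffordMatrix (v i) * cliffordMatrix (v i) = 1 := by
    rw [cliffordMatrix_mul_self, real_inner_self_eq_norm_sq, hv.1 i]
    simp
  have hsq' (i : Fin 4) (M : Matrix (Fin 8 ⊕ Fin 8) (Fin 8 ⊕ Fin 8) ℝ) :
      cliffordMatrix (v i) * (cliffordMatrix (v i) * M) = M := by
    rw [← mul_assoc, hsq, one_mul]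
  simp only [frameMatrix, Matrix.transpose_mul, transpose_cliffordMatrix, mul_assoc, hsq', hsq]

lemma Orthonormal.frameMatrix_mulVec_cayleySpinor (hv : Orthonormal ℝ v) (h : Phi0 v = 1) :
    frameMatrix v *ᵥ cayleySpinor = cayleySpinor := by
  refine mulVec_eq_self_of_dotProduct_eq_one hv.transpose_frameMatrix_mul_self
    cayleySpinor_dotProduct_self ?_
  have hPhi : Phi (v 0) (v 1) (v 2) (v 3) = Phi0 v := by
    rw [Phi]
    congr 1
    ext i
    fin_cases i <;> rfl
  rw [frameMatrix, cayleySpinor_dotProduct_cliffordMatrix, hPhi, h,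
    hv.2 (by decide : (0 : Fin 4) ≠ 1), hv.2 (by decide : (0 : Fin 4) ≠ 2),
    hv.2 (by decide : (0 : Fin 4) ≠ 3)]
  simp

lemma frameMatrix_semiconjBy_of_inner_eq_zero {n : E8} (hn : ∀ i, ⟪v i, n⟫ = 0) :
    SemiconjBy (frameMatrix v) (cliffordMatrix n) (cliffordMatrix n) := by
  have h (i : Fin 4) := cliffordMatrix_semiconjBy_neg (hn i)
  have h' (i : Fin 4) :
      SemiconjBy (cliffordMatrix (v i)) (-cliffordMatrix n) (cliffordMatrix n) := by
    simpa using (h i).neg_right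
  exact (((h' 0).mul_left (h 1)).mul_left (h' 2)).mul_left (h 3)

lemma Orthonormal.frameMatrix_semiconjBy_neg (hv : Orthonormal ℝ v) (i : Fin 4) :
    SemiconjBy (frameMatrix v) (cliffordMatrix (v i)) (-cliffordMatrix (v i)) := by
  have h {j : Fin 4} (hj : j ≠ i) := cliffordMatrix_semiconjBy_neg (hv.2 hj)
  have h' {j : Fin 4} (hj : j ≠ i) :
      SemiconjBy (cliffordMatrix (v j)) (-cliffordMatrix (v i)) (cliffordMatrix (v i)) := by
    simpa using (h hj).neg_right
  have hc : SemiconjBy (cliffordMatrix (v i)) (cliffordMatrix (v i)) (cliffordMatrix (v i)) := rfl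
  have hc' := hc.neg_right
  fin_cases i
  · exact ((hc'.mul_left (h (by decide))).mul_left (h' (by decide))).mul_left (h (by decide))
  · exact (((h (by decide)).mul_left hc).mul_left (h' (by decide))).mul_left (h (by decide))
  · exact (((h (by decide)).mul_left (h' (by decide))).mul_left hc').mul_left (h (by decide))
  · exact (((h (by decide)).mul_left (h' (by decide))).mul_left (h (by decide))).mul_left hc

lemma Orthonormal.frameMatrix_semiconjBy_neg_of_mem_span (hv : Orthonormal ℝ v) {a : E8}
    (ha : a ∈ Submodule.span ℝ (Set.range v)) :
    SemiconjBy (frameMatrix v) (cliffordMatrix a) (-cliffordMatrix a) := by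
  induction ha using Submodule.span_induction with
  | mem x hx =>
    obtain ⟨i, rfl⟩ := hx
    exact hv.frameMatrix_semiconjBy_neg i
  | zero => simp
  | add x y _ _ hx hy => simpa [add_comm] using hx.add_right hy
  | smul r x _ hx =>
    rw [SemiconjBy] at hx ⊢
    simpa using congrArg (r • ·) hx

end Frame

lemma span_range_eq_of_orthonormal {X : Submodule ℝ E8} {v : Fin 4 → E8}
    (hX : Module.finrank ℝ X = 4) (hvX : ∀ i, v i ∈ X) (hv : Orthonormal ℝ v) :
    Submodule.span ℝ (Set.range v) = X := by
  refine Submodule.eq_of_le_of_finrank_eq (Submodule.span_le.2 (Set.range_subset_iff.2 hvX)) ?_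
  rw [finrank_span_eq_card hv.linearIndependent, hX, Fintype.card_fin]

/-- Restriction of the triple cross product to a Cayley subspace `X` and its orthogonal
complement: `X×X×X → X`, `X×X×Xᗮ → Xᗮ`, `X×Xᗮ×Xᗮ → X`, `Xᗮ×Xᗮ×Xᗮ → Xᗮ`. -/
theorem crossTriple_restriction (X : Submodule ℝ E8) (hX : IsCayley X) :
    (∀ a b c : E8, a ∈ X → b ∈ X → c ∈ X → crossTriple a b c ∈ X) ∧
    (∀ a b n : E8, a ∈ X → b ∈ X → n ∈ Xᗮ → crossTriple a b n ∈ Xᗮ) ∧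
    (∀ a m n : E8, a ∈ X → m ∈ Xᗮ → n ∈ Xᗮ → crossTriple a m n ∈ X) ∧
    (∀ l m n : E8, l ∈ Xᗮ → m ∈ Xᗮ → n ∈ Xᗮ → crossTriple l m n ∈ Xᗮ) := by
  obtain ⟨hdim, v, hvX, hv, hPhi⟩ := hX
  have hspan := span_range_eq_of_orthonormal hdim hvX hv
  have hodd {a : E8} (ha : a ∈ X) :
      SemiconjBy (frameMatrix v) (cliffordMatrix a) (-cliffordMatrix a) :=
    hv.frameMatrix_semiconjBy_neg_of_mem_span (hspan ▸ ha)
  have heven {n : E8} (hn : n ∈ Xᗮ) :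
      SemiconjBy (frameMatrix v) (cliffordMatrix n) (cliffordMatrix n) :=
    frameMatrix_semiconjBy_of_inner_eq_zero fun i => hn _ (hvX i)
  have horth {a n : E8} (ha : a ∈ X) (hn : n ∈ Xᗮ) : ⟪a, n⟫ = 0 := hn a ha
  have horth' {a n : E8} (ha : a ∈ X) (hn : n ∈ Xᗮ) : ⟪n, a⟫ = 0 := by
    rw [real_inner_comm, hn a ha]
  have hzero {a b c d : E8}
      (h : SemiconjBy (frameMatrix v)
        (cliffordMatrix a * cliffordMatrix b * cliffordMatrix c * cliffordMatrix d)
        (-(cliffordMatrix a * cliffordMatrix b * cliffordMatrix c * cliffordMatrix d))) :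
      Phi a b c d + ⟪a, b⟫ * ⟪c, d⟫ - ⟪a, c⟫ * ⟪b, d⟫ + ⟪a, d⟫ * ⟪b, c⟫ = 0 := by
    rw [← cayleySpinor_dotProduct_cliffordMatrix]
    exact dotProduct_mulVec_eq_zero_of_semiconjBy_neg hv.transpose_frameMatrix_mul_self
      (hv.frameMatrix_mulVec_cayleySpinor hPhi) h
  have hmem {y : E8} (hy : ∀ n ∈ Xᗮ, ⟪n, y⟫ = 0) : y ∈ X := by
    rw [← X.orthogonal_orthogonal]
    exact hy
  refine ⟨fun a b c ha hb hc => hmem fun n hn => ?_, fun a b n ha hb hn x hx => ?_,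
    fun a m n ha hm hn => hmem fun l hl => ?_, fun l m n hl hm hn x hx => ?_⟩ <;>
    rw [inner_crossTriple]
  · have h := hzero (by simpa using (((heven hn).mul_right (hodd ha)).mul_right
      (hodd hb)).mul_right (hodd hc))
    simpa [horth' ha hn, horth' hb hn, horth' hc hn] using h
  · have h := hzero (by simpa using (((hodd hx).mul_right (hodd ha)).mul_right
      (hodd hb)).mul_right (heven hn))
    simpa [horth hx hn, horth ha hn, horth hb hn] using h
  · have h := hzero (by simpa using (((heven hl).mul_right (hodd ha)).mul_right
      (heven hm)).mul_right (heven hn))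
    simpa [horth' ha hl, horth ha hm, horth ha hn] using h
  · have h := hzero (by simpa using (((hodd hx).mul_right (heven hl)).mul_right
      (heven hm)).mul_right (heven hn))
    simpa [horth hx hl, horth hx hm, horth hx hn] using h

end
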